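/- There exist absolute constants ε₀ ∈ (0,1) and C > 0 with the following property: if 0 < ε ≤ ε₀, I > 0 and ε² ≤ ε₀·I, then there exist a real number α > 0 with |α − I/4| ≤ C·ε² and bounded, even, twice continuously differentiable functions W₁, W₂ : ℝ → ℝ such that −W₁″ + W₁ + a⁺·W₁ = (1−α²)·W₂ and −W₂″ + W₂ + a⁻·W₂ = (1−α²)·W₁ on ℝ, and which moreover satisfy, for all y ∈ ℝ, |W₁(y) − e^{−α|y|}| ≤ C·(ε²/I)·e^{−α|y|}, |W₂(y) − e^{−α|y|}| ≤ C·(ε²/I)·e^{−α|y|} and |W₁(y) − W₂(y)| ≤ C·ε·e^{−|y|} (in particular W₁ and W₂ are non-trivial). -/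

import Mathlib

open MeasureTheory

theorem integral_exp_neg_mul_abs {c : ℝ} (hc : 0 < c) :
    ∫ x : ℝ, Real.exp (-(c * |x|)) = 2 / c := by
  rw [integral_comp_abs (f := fun x => Real.exp (-(c * x)))]
  simp_rw [← neg_mul]
  rw [integral_exp_mul_Ioi (by linarith)]
  simp
  field_simp

theorem integrable_exp_neg_mul_abs {c : ℝ} (hc : 0 < c) :
    Integrable fun x : ℝ => Real.exp (-(c * |x|)) := by
  by_contra h
  have := integral_exp_neg_mul_abs hc
  rw [integral_undef h] at this
  exact (div_pos two_pos hc).ne this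

/-- The convolution of `f` with the kernel `exp (-γ|·|)`. -/
noncomputable def expConv (γ : ℝ) (f : ℝ → ℝ) (y : ℝ) : ℝ :=
  ∫ x, Real.exp (-(γ * |y - x|)) * f x

theorem hasDerivAt_integral_Iic {f : ℝ → ℝ} (hf : Continuous f)
    (hi : ∀ y, IntegrableOn f (Set.Iic y)) (y : ℝ) :
    HasDerivAt (fun y => ∫ x in Set.Iic y, f x) (f y) y := by
  have h : (fun y => ∫ x in Set.Iic y, f x)
      = fun y => (∫ x in Set.Iic 0, f x) + ∫ x in (0 : ℝ)..y, f x := by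
    ext y
    rw [← intervalIntegral.integral_Iic_sub_Iic (hi 0) (hi y)]
    ring
  rw [h]
  exact (hf.integral_hasStrictDerivAt 0 y).hasDerivAt.const_add _

theorem hasDerivAt_integral_Ioi {f : ℝ → ℝ} (hf : Continuous f)
    (hi : ∀ y, IntegrableOn f (Set.Ioi y)) (y : ℝ) :
    HasDerivAt (fun y => ∫ x in Set.Ioi y, f x) (-f y) y := by
  have h : (fun y => ∫ x in Set.Ioi y, f x)
      = fun y => (∫ x in Set.Ioi 0, f x) - ∫ x in (0 : ℝ)..y, f x := by
    ext y
    rw [← intervalIntegral.integral_Ioi_sub_Ioi' (hi 0) (hi y)]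
    ring
  rw [h]
  exact (hf.integral_hasStrictDerivAt 0 y).hasDerivAt.const_sub _

theorem integrableOn_exp_mul_mul_Iic {γ M : ℝ} (hγ : 0 < γ) {f : ℝ → ℝ} (hf : Continuous f)
    (hM : ∀ x, |f x| ≤ M) (y : ℝ) :
    IntegrableOn (fun x => Real.exp (γ * x) * f x) (Set.Iic y) := by
  have h := integrableOn_exp_mul_Iic hγ y
  refine Integrable.mul_bdd (c := M) h hf.aestronglyMeasurable ?_
  exact Filter.Eventually.of_forall hM

theorem integrableOn_exp_mul_mul_Ioi {γ M : ℝ} (hγ : 0 < γ) {f : ℝ → ℝ} (hf : Continuous f)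
    (hM : ∀ x, |f x| ≤ M) (y : ℝ) :
    IntegrableOn (fun x => Real.exp (-γ * x) * f x) (Set.Ioi y) := by
  have h := integrableOn_exp_mul_Ioi (neg_lt_zero.2 hγ) y
  refine Integrable.mul_bdd (c := M) h hf.aestronglyMeasurable ?_
  exact Filter.Eventually.of_forall hM

theorem expConv_eq {γ M : ℝ} (hγ : 0 < γ) {f : ℝ → ℝ} (hf : Continuous f)
    (hM : ∀ x, |f x| ≤ M) (y : ℝ) :
    expConv γ f y = Real.exp (-γ * y) * (∫ x in Set.Iic y, Real.exp (γ * x) * f x)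
      + Real.exp (γ * y) * ∫ x in Set.Ioi y, Real.exp (-γ * x) * f x := by
  have h₁ := (integrableOn_exp_mul_mul_Iic hγ hf hM y).const_mul (Real.exp (-γ * y))
  have h₂ := (integrableOn_exp_mul_mul_Ioi hγ hf hM y).const_mul (Real.exp (γ * y))
  have e₁ : Set.EqOn (fun x => Real.exp (-γ * y) * (Real.exp (γ * x) * f x))
      (fun x => Real.exp (-(γ * |y - x|)) * f x) (Set.Iic y) := by
    intro x hx
    simp only [Set.mem_Iic] at hx
    simp only
    rw [abs_of_nonneg (sub_nonneg.2 hx), ← mul_assoc, ← Real.exp_add]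
    ring_nf
  have e₂ : Set.EqOn (fun x => Real.exp (γ * y) * (Real.exp (-γ * x) * f x))
      (fun x => Real.exp (-(γ * |y - x|)) * f x) (Set.Ioi y) := by
    intro x hx
    simp only [Set.mem_Ioi] at hx
    simp only
    rw [abs_of_neg (sub_neg.2 hx), ← mul_assoc, ← Real.exp_add]
    ring_nf
  rw [expConv, ← integral_const_mul, ← integral_const_mul,
    setIntegral_congr_fun measurableSet_Iic e₁,
    setIntegral_congr_fun measurableSet_Ioi e₂, intervalIntegral.integral_Iic_add_Ioi]
  · exact IntegrableOn.congr_fun h₁ e₁ measurableSet_Iic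
  · exact IntegrableOn.congr_fun h₂ e₂ measurableSet_Ioi

/-- `expConv γ f` solves `-P'' + γ² P = 2 γ f`. -/
theorem exists_hasDerivAt_expConv {γ M : ℝ} (hγ : 0 < γ) {f : ℝ → ℝ} (hf : Continuous f)
    (hM : ∀ x, |f x| ≤ M) :
    ∃ g : ℝ → ℝ, (∀ y, HasDerivAt (expConv γ f) (g y) y) ∧
      ∀ y, HasDerivAt g (γ ^ 2 * expConv γ f y - 2 * γ * f y) y := by
  have hA := hasDerivAt_integral_Iic (f := fun x => Real.exp (γ * x) * f x) (by fun_prop)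
    (integrableOn_exp_mul_mul_Iic hγ hf hM)
  have hB := hasDerivAt_integral_Ioi (f := fun x => Real.exp (-γ * x) * f x) (by fun_prop)
    (integrableOn_exp_mul_mul_Ioi hγ hf hM)
  have hE (c y : ℝ) : HasDerivAt (fun y => Real.exp (c * y)) (Real.exp (c * y) * c) y := by
    simpa using ((hasDerivAt_id y).const_mul c).exp
  have hcancel (y : ℝ) : Real.exp (-γ * y) * Real.exp (γ * y) = 1 := by
    rw [← Real.exp_add]; simp
  have hP : expConv γ f = _ := funext (expConv_eq hγ hf hM)
  refine ⟨fun y => -γ * (Real.exp (-γ * y) * (∫ x in Set.Iic y, Real.exp (γ * x) * f x))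
      + γ * (Real.exp (γ * y) * ∫ x in Set.Ioi y, Real.exp (-γ * x) * f x), fun y => ?_,
      fun y => ?_⟩
  · rw [hP]
    refine (((hE (-γ) y).mul (hA y)).add ((hE γ y).mul (hB y))).congr_deriv ?_
    ring
  · refine ((((hE (-γ) y).mul (hA y)).const_mul (-γ)).add
      (((hE γ y).mul (hB y)).const_mul γ)).congr_deriv ?_
    rw [expConv_eq hγ hf hM]
    linear_combination (-2 * γ * f y) * hcancel y

theorem abs_integral_le_of_decay {g : ℝ → ℝ} {M : ℝ}
    (h : ∀ x, |g x| ≤ M * Real.exp (-(2 / 5 * |x|))) : |∫ x, g x| ≤ 5 * M := by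
  have hi := (integrable_exp_neg_mul_abs (c := 2 / 5) (by norm_num)).const_mul M
  have := norm_integral_le_of_norm_le (f := g) hi (Filter.Eventually.of_forall h)
  rw [integral_const_mul, integral_exp_neg_mul_abs (by norm_num), Real.norm_eq_abs] at this
  linarith

theorem abs_expConv_le {γ M : ℝ} (hγ : 7 / 5 ≤ γ) {f : ℝ → ℝ}
    (h : ∀ x, |f x| ≤ M * Real.exp (-|x|)) (y : ℝ) :
    |expConv γ f y| ≤ 5 * M * Real.exp (-|y|) := by
  have hM : 0 ≤ M := by
    have := (abs_nonneg _).trans (h 0)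
    simpa using this
  rw [expConv, ← integral_sub_left_eq_self _ volume y]
  refine (abs_integral_le_of_decay (M := M * Real.exp (-|y|)) fun x => ?_).trans_eq (by ring)
  rw [abs_mul, Real.abs_exp]
  calc _ ≤ Real.exp (-(γ * |y - (y - x)|)) * (M * Real.exp (-|y - x|)) := by gcongr; exact h _
    _ = M * Real.exp (-(γ * |x|) + -|y - x|) := by rw [Real.exp_add]; ring_nf
    _ ≤ M * Real.exp (-|y| + -(2 / 5 * |x|)) := by
      refine mul_le_mul_of_nonneg_left (Real.exp_le_exp.2 ?_) hM
      have h₁ : |y| ≤ |y - x| + |x| := by simpa using abs_add_le (y - x) x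
      nlinarith [abs_nonneg x]
    _ = _ := by rw [Real.exp_add]; ring

theorem abs_exp_sub_exp_le {p q m : ℝ} (hp : p ≤ m) (hq : q ≤ m) :
    |Real.exp p - Real.exp q| ≤ |p - q| * Real.exp m := by
  wlog h : q ≤ p generalizing p q
  · rw [abs_sub_comm, abs_sub_comm p]
    exact this hq hp (le_of_not_ge h)
  rw [abs_of_nonneg (sub_nonneg.2 (Real.exp_le_exp.2 h)), abs_of_nonneg (sub_nonneg.2 h)]
  have h₁ : Real.exp p * Real.exp (q - p) = Real.exp q := by rw [← Real.exp_add]; ring_nf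
  have h₂ := Real.add_one_le_exp (q - p)
  have h₃ := Real.exp_le_exp.2 hp
  nlinarith [Real.exp_pos p]

/-- The difference quotient `(exp (α t) - 1) / α`, extended continuously to `α = 0`. -/
noncomputable def expQuot (α t : ℝ) : ℝ := ∫ s in (0 : ℝ)..1, t * Real.exp (α * t * s)

theorem mul_expQuot (α t : ℝ) : α * expQuot α t = Real.exp (α * t) - 1 := by
  have h (s : ℝ) : HasDerivAt (fun s => Real.exp (α * t * s)) (Real.exp (α * t * s) * (α * t)) s := by
    simpa using ((hasDerivAt_id s).const_mul (α * t)).exp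
  have := intervalIntegral.integral_eq_sub_of_hasDerivAt (a := 0) (b := 1) (fun s _ => h s)
    (Continuous.intervalIntegrable (by fun_prop) _ _)
  simp only [mul_one, mul_zero, Real.exp_zero] at this
  rw [← this, expQuot, ← intervalIntegral.integral_const_mul]
  congr 1 with s
  ring

theorem continuous_expQuot (α : ℝ) : Continuous (expQuot α) := by
  apply intervalIntegral.continuous_parametric_intervalIntegral_of_continuous'
  fun_prop

theorem mul_mul_le_abs_div_ten {α t s : ℝ} (hα : |α| ≤ 1 / 10) (hs : s ∈ Set.uIoc (0 : ℝ) 1) :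
    α * t * s ≤ |t| / 10 := by
  rw [Set.uIoc_of_le zero_le_one] at hs
  refine (le_abs_self _).trans ?_
  rw [abs_mul, abs_mul, abs_of_pos hs.1]
  have := mul_le_mul hα hs.2 hs.1.le (by norm_num)
  nlinarith [abs_nonneg t]

theorem abs_expQuot_le {α : ℝ} (hα : |α| ≤ 1 / 10) (t : ℝ) :
    |expQuot α t| ≤ |t| * Real.exp (|t| / 10) := by
  have := intervalIntegral.norm_integral_le_of_norm_le_const (a := 0) (b := 1)
    (f := fun s => t * Real.exp (α * t * s)) (C := |t| * Real.exp (|t| / 10)) fun s hs => by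
      rw [norm_mul, Real.norm_eq_abs, Real.norm_eq_abs, Real.abs_exp]
      gcongr
      exact mul_mul_le_abs_div_ten hα hs
  simpa [expQuot] using this

theorem abs_expQuot_sub_le {α α' : ℝ} (hα : |α| ≤ 1 / 10) (hα' : |α'| ≤ 1 / 10) (t : ℝ) :
    |expQuot α t - expQuot α' t| ≤ |α - α'| * t ^ 2 * Real.exp (|t| / 10) := by
  rw [expQuot, expQuot, ← intervalIntegral.integral_sub
    (Continuous.intervalIntegrable (by fun_prop) _ _)
    (Continuous.intervalIntegrable (by fun_prop) _ _)]
  have := intervalIntegral.norm_integral_le_of_norm_le_const (a := 0) (b := 1)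
    (f := fun s => t * Real.exp (α * t * s) - t * Real.exp (α' * t * s))
    (C := |α - α'| * t ^ 2 * Real.exp (|t| / 10)) fun s hs => by
      have h := abs_exp_sub_exp_le (mul_mul_le_abs_div_ten (t := t) hα hs)
        (mul_mul_le_abs_div_ten (t := t) hα' hs)
      rw [Set.uIoc_of_le zero_le_one] at hs
      rw [← mul_sub, Real.norm_eq_abs, abs_mul]
      have e : |α * t * s - α' * t * s| = |α - α'| * |t| * s := by
        rw [← sub_mul, ← sub_mul, abs_mul, abs_mul, abs_of_pos hs.1]
      rw [e] at h
      calc _ ≤ |t| * (|α - α'| * |t| * 1 * Real.exp (|t| / 10)) := by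
            refine mul_le_mul_of_nonneg_left (h.trans ?_) (abs_nonneg t)
            gcongr
            exact hs.2
        _ = _ := by rw [← sq_abs t]; ring
  simpa using this

theorem abs_expQuot_le_exp {α t r : ℝ} (hα : |α| ≤ 1 / 10) (ht : |t| ≤ r) :
    |expQuot α t| ≤ 2 * Real.exp r := by
  have hr : 0 ≤ r := (abs_nonneg t).trans ht
  have h := Real.add_one_le_exp (r / 2)
  calc _ ≤ |t| * Real.exp (|t| / 10) := abs_expQuot_le hα t
    _ ≤ (2 * Real.exp (r / 2)) * Real.exp (r / 2) := by
      gcongr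
      · linarith
      · linarith
    _ = _ := by rw [mul_assoc, ← Real.exp_add, add_halves]

theorem abs_expQuot_sub_le_exp {α α' t r : ℝ} (hα : |α| ≤ 1 / 10) (hα' : |α'| ≤ 1 / 10)
    (ht : |t| ≤ r) : |expQuot α t - expQuot α' t| ≤ 8 * |α - α'| * Real.exp r := by
  have hr : 0 ≤ r := (abs_nonneg t).trans ht
  have h := Real.quadratic_le_exp_of_nonneg (x := r / 2) (by positivity)
  have ht2 : t ^ 2 ≤ 8 * Real.exp (r / 2) := by
    rw [← sq_abs]
    nlinarith [abs_nonneg t]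
  calc _ ≤ |α - α'| * t ^ 2 * Real.exp (|t| / 10) := abs_expQuot_sub_le hα hα' t
    _ ≤ |α - α'| * (8 * Real.exp (r / 2)) * Real.exp (r / 2) := by
      gcongr
      linarith
    _ = 8 * |α - α'| * (Real.exp (r / 2) * Real.exp (r / 2)) := by ring
    _ = _ := by rw [← Real.exp_add, add_halves]

theorem abs_abs_sub_abs_sub_le (x y : ℝ) : |(|y| - |y - x|)| ≤ |x| := by
  simpa using abs_abs_sub_abs_le y (y - x)

/-- Continuous even potentials of size `ε` decaying like `exp (-2|y|)`. -/
structure IsPotential (ε : ℝ) (a : ℝ → ℝ) : Prop where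
  cont : Continuous a
  even : ∀ y, a (-y) = a y
  bound : ∀ y, |a y| ≤ ε * Real.exp (-2 * |y|)

/-- The complete set of profiles and decay rates on which the fixed point is sought. -/
structure IsProfile (u v : ℝ → ℝ) (α : ℝ) : Prop where
  contu : Continuous u
  contv : Continuous v
  evenu : ∀ y, u (-y) = u y
  evenv : ∀ y, v (-y) = v y
  boundu : ∀ y, |u y| ≤ 2
  boundv : ∀ y, |v y| ≤ 1
  bounda : |α| ≤ 1 / 10

/-- The coupling term `a Z₁ + b Z₂` with `Z₁ = exp (-α|·|) u` and `Z₂ = exp (-|·|) v`. -/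
noncomputable def source (α : ℝ) (a b u v : ℝ → ℝ) (x : ℝ) : ℝ :=
  a x * (Real.exp (-(α * |x|)) * u x) + b x * (Real.exp (-|x|) * v x)

theorem IsPotential.nonneg {ε : ℝ} {a : ℝ → ℝ} (ha : IsPotential ε a) : 0 ≤ ε := by
  simpa using (abs_nonneg _).trans (ha.bound 0)

section
variable {ε α α' Δ : ℝ} {a b u v u' v' : ℝ → ℝ}

theorem continuous_source (ha : IsPotential ε a) (hb : IsPotential ε b) (h : IsProfile u v α) :
    Continuous (source α a b u v) := by
  have := ha.cont
  have := hb.cont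
  have := h.contu
  have := h.contv
  unfold source
  fun_prop

theorem source_neg (ha : IsPotential ε a) (hb : IsPotential ε b) (h : IsProfile u v α) (x : ℝ) :
    source α a b u v (-x) = source α a b u v x := by
  simp [source, ha.even, hb.even, h.evenu, h.evenv]

theorem neg_mul_abs_le (hα : |α| ≤ 1 / 10) (x : ℝ) : -(α * |x|) ≤ |x| / 10 := by
  nlinarith [abs_nonneg x, neg_abs_le α]

theorem abs_source_le (ha : IsPotential ε a) (hb : IsPotential ε b) (h : IsProfile u v α) (x : ℝ) :
    |source α a b u v x| ≤ 3 * ε * Real.exp (-(7 / 5 * |x|)) := by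
  have hε := ha.nonneg
  have hx := abs_nonneg x
  have h₁ : |a x * (Real.exp (-(α * |x|)) * u x)| ≤ 2 * ε * Real.exp (-(7 / 5 * |x|)) := by
    rw [abs_mul, abs_mul, Real.abs_exp]
    calc _ ≤ (ε * Real.exp (-2 * |x|)) * (Real.exp (|x| / 10) * 2) := by
          gcongr
          · exact ha.bound x
          · exact neg_mul_abs_le h.bounda x
          · exact h.boundu x
      _ = 2 * ε * Real.exp (-2 * |x| + |x| / 10) := by rw [Real.exp_add]; ring
      _ ≤ _ := by gcongr; linarith
  have h₂ : |b x * (Real.exp (-|x|) * v x)| ≤ 1 * ε * Real.exp (-(7 / 5 * |x|)) := by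
    rw [abs_mul, abs_mul, Real.abs_exp]
    calc _ ≤ (ε * Real.exp (-2 * |x|)) * (Real.exp (-|x|) * 1) := by
          gcongr
          · exact hb.bound x
          · exact h.boundv x
      _ = 1 * ε * Real.exp (-2 * |x| + -|x|) := by rw [Real.exp_add]; ring
      _ ≤ _ := by gcongr; linarith
  calc _ ≤ _ := abs_add_le _ _
    _ ≤ _ := add_le_add h₁ h₂
    _ = _ := by ring

theorem abs_source_sub_le (ha : IsPotential ε a) (hb : IsPotential ε b) (h : IsProfile u v α)
    (h' : IsProfile u' v' α') (hu : ∀ y, |u y - u' y| ≤ Δ) (hv : ∀ y, |v y - v' y| ≤ Δ)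
    (hα : |α - α'| ≤ Δ) (x : ℝ) :
    |source α a b u v x - source α' a b u' v' x| ≤ 4 * ε * Δ * Real.exp (-(7 / 5 * |x|)) := by
  have hε := ha.nonneg
  have hx := abs_nonneg x
  have hΔ := (abs_nonneg _).trans hα
  have e : source α a b u v x - source α' a b u' v' x
      = a x * ((Real.exp (-(α * |x|)) - Real.exp (-(α' * |x|))) * u x
        + Real.exp (-(α' * |x|)) * (u x - u' x)) + b x * (Real.exp (-|x|) * (v x - v' x)) := by
    unfold source
    ring
  have h₀ : |Real.exp (-(α * |x|)) - Real.exp (-(α' * |x|))|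
      ≤ Δ * |x| * Real.exp (|x| / 10) := by
    refine (abs_exp_sub_exp_le (neg_mul_abs_le h.bounda x) (neg_mul_abs_le h'.bounda x)).trans ?_
    gcongr
    rw [show -(α * |x|) - -(α' * |x|) = -(α - α') * |x| by ring, abs_mul, abs_neg, abs_abs]
    gcongr
  have h₁ : |a x * ((Real.exp (-(α * |x|)) - Real.exp (-(α' * |x|))) * u x
        + Real.exp (-(α' * |x|)) * (u x - u' x))|
        ≤ (ε * Real.exp (-2 * |x|)) * ((Δ * |x| * Real.exp (|x| / 10)) * 2
          + Real.exp (|x| / 10) * Δ) := by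
    rw [abs_mul]
    refine mul_le_mul (ha.bound x) ((abs_add_le _ _).trans ?_) (abs_nonneg _) (by positivity)
    rw [abs_mul, abs_mul, Real.abs_exp]
    gcongr
    · exact h.boundu x
    · exact neg_mul_abs_le h'.bounda x
    · exact hu x
  have h₂ : |b x * (Real.exp (-|x|) * (v x - v' x))| ≤
      (ε * Real.exp (-2 * |x|)) * (Real.exp (|x| / 10) * Δ) := by
    rw [abs_mul, abs_mul, Real.abs_exp]
    gcongr
    · exact hb.bound x
    · linarith
    · exact hv x
  have h₃ := Real.add_one_le_exp (|x| / 2)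
  rw [e]
  calc _ ≤ _ := abs_add_le _ _
    _ ≤ _ := add_le_add h₁ h₂
    _ = 4 * ε * Δ * (Real.exp (-2 * |x|) * ((|x| / 2 + 1 / 2) * Real.exp (|x| / 10))) := by ring
    _ ≤ 4 * ε * Δ * (Real.exp (-2 * |x|) * (Real.exp (|x| / 2) * Real.exp (|x| / 10))) := by
      gcongr
      linarith
    _ = 4 * ε * Δ * Real.exp (-(7 / 5 * |x|)) := by
      rw [← Real.exp_add, ← Real.exp_add]
      ring_nf

/-- Next iterate for the slowly decaying profile. -/
noncomputable def nextU (α : ℝ) (a b u v : ℝ → ℝ) (y : ℝ) : ℝ :=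
  1 - 1 / 2 * ∫ x, expQuot α (|y| - |y - x|) * source α a b u v x

/-- Right-hand side of the equation for the rapidly decaying component. -/
noncomputable def sourceV (α : ℝ) (a b u v : ℝ → ℝ) (x : ℝ) : ℝ :=
  α ^ 2 * (Real.exp (-|x|) * v x) - source α b a u v x

/-- Next iterate for the rapidly decaying profile. -/
noncomputable def nextV (α : ℝ) (a b u v : ℝ → ℝ) (y : ℝ) : ℝ :=
  Real.exp |y| * (1 / (2 * √2) * expConv (√2) (sourceV α a b u v) y)

/-- Next iterate for the decay rate. -/
noncomputable def nextRate (α : ℝ) (a b u v : ℝ → ℝ) : ℝ :=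
  -(1 / 2) * ∫ x, source α a b u v x

theorem abs_kernel_mul_source_le (ha : IsPotential ε a) (hb : IsPotential ε b)
    (h : IsProfile u v α) (y x : ℝ) :
    |expQuot α (|y| - |y - x|) * source α a b u v x| ≤ 6 * ε * Real.exp (-(2 / 5 * |x|)) := by
  rw [abs_mul]
  calc _ ≤ (2 * Real.exp |x|) * (3 * ε * Real.exp (-(7 / 5 * |x|))) :=
        mul_le_mul (abs_expQuot_le_exp h.bounda (abs_abs_sub_abs_sub_le x y))
          (abs_source_le ha hb h x) (abs_nonneg _) (by positivity)
    _ = 6 * ε * Real.exp (|x| + -(7 / 5 * |x|)) := by rw [Real.exp_add]; ring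
    _ = _ := by ring_nf

theorem integrable_of_decay {g : ℝ → ℝ} {M : ℝ} (hg : Continuous g)
    (h : ∀ x, |g x| ≤ M * Real.exp (-(2 / 5 * |x|))) : Integrable g :=
  ((integrable_exp_neg_mul_abs (c := 2 / 5) (by norm_num)).const_mul M).mono'
    hg.aestronglyMeasurable (Filter.Eventually.of_forall h)

theorem continuous_kernel_mul_source (ha : IsPotential ε a) (hb : IsPotential ε b)
    (h : IsProfile u v α) :
    Continuous fun p : ℝ × ℝ => expQuot α (|p.1| - |p.1 - p.2|) * source α a b u v p.2 := by
  have h₁ := continuous_expQuot α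
  have h₂ := continuous_source ha hb h
  fun_prop

theorem integrable_kernel_mul_source (ha : IsPotential ε a) (hb : IsPotential ε b)
    (h : IsProfile u v α) (y : ℝ) :
    Integrable fun x => expQuot α (|y| - |y - x|) * source α a b u v x :=
  integrable_of_decay ((continuous_kernel_mul_source ha hb h).comp (Continuous.prodMk_right y))
    (abs_kernel_mul_source_le ha hb h y)

theorem continuous_nextU (ha : IsPotential ε a) (hb : IsPotential ε b) (h : IsProfile u v α) :
    Continuous (nextU α a b u v) := by
  have hc := continuous_kernel_mul_source ha hb h
  refine continuous_const.sub (continuous_const.mul ?_)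
  refine continuous_of_dominated (bound := fun x => 6 * ε * Real.exp (-(2 / 5 * |x|)))
    (fun y => (hc.comp (Continuous.prodMk_right y)).aestronglyMeasurable)
    (fun y => Filter.Eventually.of_forall (abs_kernel_mul_source_le ha hb h y))
    ((integrable_exp_neg_mul_abs (by norm_num)).const_mul _)
    (Filter.Eventually.of_forall fun x => hc.comp (Continuous.prodMk_left x))

theorem abs_nextU_sub_one_le (ha : IsPotential ε a) (hb : IsPotential ε b) (h : IsProfile u v α)
    (y : ℝ) : |nextU α a b u v y - 1| ≤ 15 * ε := by
  have := abs_integral_le_of_decay (abs_kernel_mul_source_le ha hb h y)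
  rw [nextU, sub_sub_cancel_left, abs_neg, abs_mul, abs_of_pos one_half_pos]
  linarith

theorem abs_nextU_sub_le (ha : IsPotential ε a) (hb : IsPotential ε b) (h : IsProfile u v α)
    (h' : IsProfile u' v' α') (hu : ∀ y, |u y - u' y| ≤ Δ) (hv : ∀ y, |v y - v' y| ≤ Δ)
    (hα : |α - α'| ≤ Δ) (y : ℝ) :
    |nextU α a b u v y - nextU α' a b u' v' y| ≤ 80 * ε * Δ := by
  have hε := ha.nonneg
  have hΔ := (abs_nonneg _).trans hα
  have e : nextU α a b u v y - nextU α' a b u' v' y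
      = -(1 / 2) * ∫ x, (expQuot α (|y| - |y - x|) * source α a b u v x
        - expQuot α' (|y| - |y - x|) * source α' a b u' v' x) := by
    rw [integral_sub (integrable_kernel_mul_source ha hb h y)
      (integrable_kernel_mul_source ha hb h' y), nextU, nextU]
    ring
  have hi := abs_integral_le_of_decay (M := 32 * ε * Δ) (g := fun x =>
      expQuot α (|y| - |y - x|) * source α a b u v x
        - expQuot α' (|y| - |y - x|) * source α' a b u' v' x) fun x => by
    have ht := abs_abs_sub_abs_sub_le x y
    set t := |y| - |y - x|
    calc _ = |expQuot α t * (source α a b u v x - source α' a b u' v' x)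
          + (expQuot α t - expQuot α' t) * source α' a b u' v' x| := by ring_nf
      _ ≤ (2 * Real.exp |x|) * (4 * ε * Δ * Real.exp (-(7 / 5 * |x|)))
          + (8 * Δ * Real.exp |x|) * (3 * ε * Real.exp (-(7 / 5 * |x|))) := by
        refine (abs_add_le _ _).trans ?_
        rw [abs_mul, abs_mul]
        gcongr
        · exact abs_expQuot_le_exp h.bounda ht
        · exact abs_source_sub_le ha hb h h' hu hv hα x
        · exact (abs_expQuot_sub_le_exp h.bounda h'.bounda ht).trans (by gcongr)
        · exact abs_source_le ha hb h' x
      _ = 32 * ε * Δ * Real.exp (|x| + -(7 / 5 * |x|)) := by rw [Real.exp_add]; ring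
      _ = _ := by ring_nf
  rw [e, abs_mul, abs_neg, abs_of_pos one_half_pos]
  linarith

theorem nextU_neg (ha : IsPotential ε a) (hb : IsPotential ε b) (h : IsProfile u v α) (y : ℝ) :
    nextU α a b u v (-y) = nextU α a b u v y := by
  rw [nextU, nextU, ← integral_neg_eq_self]
  congr 3 with x
  rw [source_neg ha hb h, abs_neg, show -y - -x = -(y - x) by ring, abs_neg]

theorem expConv_neg {γ : ℝ} {f : ℝ → ℝ} (hf : ∀ x, f (-x) = f x) (y : ℝ) :
    expConv γ f (-y) = expConv γ f y := by
  rw [expConv, expConv, ← integral_neg_eq_self]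
  congr 1 with x
  rw [hf, show -y - -x = -(y - x) by ring, abs_neg]

theorem source_integrable (ha : IsPotential ε a) (hb : IsPotential ε b) (h : IsProfile u v α) :
    Integrable (source α a b u v) :=
  integrable_of_decay (M := 3 * ε) (continuous_source ha hb h) fun x => by
    have hε := ha.nonneg
    refine (abs_source_le ha hb h x).trans ?_
    gcongr
    norm_num

theorem abs_nextRate_le (ha : IsPotential ε a) (hb : IsPotential ε b) (h : IsProfile u v α) :
    |nextRate α a b u v| ≤ 15 / 2 * ε := by
  have hε := ha.nonneg
  have := abs_integral_le_of_decay (M := 3 * ε) (g := source α a b u v) fun x => by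
    refine (abs_source_le ha hb h x).trans ?_
    gcongr
    norm_num
  rw [nextRate, abs_mul, abs_neg, abs_of_pos one_half_pos]
  linarith

theorem abs_nextRate_sub_le (ha : IsPotential ε a) (hb : IsPotential ε b) (h : IsProfile u v α)
    (h' : IsProfile u' v' α') (hu : ∀ y, |u y - u' y| ≤ Δ) (hv : ∀ y, |v y - v' y| ≤ Δ)
    (hα : |α - α'| ≤ Δ) :
    |nextRate α a b u v - nextRate α' a b u' v'| ≤ 10 * ε * Δ := by
  have hε := ha.nonneg
  have hΔ := (abs_nonneg _).trans hα
  have := abs_integral_le_of_decay (M := 4 * ε * Δ)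
    (g := fun x => source α a b u v x - source α' a b u' v' x) fun x => by
      refine (abs_source_sub_le ha hb h h' hu hv hα x).trans ?_
      gcongr
      norm_num
  rw [integral_sub (source_integrable ha hb h) (source_integrable ha hb h')] at this
  rw [nextRate, nextRate, ← mul_sub, abs_mul, abs_neg, abs_of_pos one_half_pos]
  linarith

theorem seven_fifths_le_sqrt_two : (7 / 5 : ℝ) ≤ √2 :=
  Real.le_sqrt_of_sq_le (by norm_num)

theorem abs_exp_mul_expConv_sqrt_two_le {M : ℝ} {f : ℝ → ℝ}
    (h : ∀ x, |f x| ≤ M * Real.exp (-|x|)) (y : ℝ) :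
    |Real.exp |y| * (1 / (2 * √2) * expConv (√2) f y)| ≤ 2 * M := by
  have hM : 0 ≤ M := by
    have := (abs_nonneg _).trans (h 0)
    simpa using this
  have h₁ := abs_expConv_le seven_fifths_le_sqrt_two h y
  have h₂ : 1 / (2 * √2) ≤ 2 / 5 := by
    have := seven_fifths_le_sqrt_two
    rw [div_le_div_iff₀ (by positivity) (by norm_num)]
    linarith
  rw [abs_mul, abs_mul, Real.abs_exp, abs_of_pos (by positivity : 0 < 1 / (2 * √2))]
  calc _ ≤ Real.exp |y| * (2 / 5 * (5 * M * Real.exp (-|y|))) := by gcongr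
    _ = 2 * M * (Real.exp |y| * Real.exp (-|y|)) := by ring
    _ = _ := by rw [← Real.exp_add]; simp

theorem abs_sourceV_le (ha : IsPotential ε a) (hb : IsPotential ε b) (h : IsProfile u v α)
    {m : ℝ} (hm : ∀ y, |v y| ≤ m) (x : ℝ) :
    |sourceV α a b u v x| ≤ (m / 100 + 3 * ε) * Real.exp (-|x|) := by
  have hε := ha.nonneg
  have hα : α ^ 2 ≤ 1 / 100 := by
    rw [← sq_abs]
    nlinarith [abs_nonneg α, h.bounda]
  calc _ ≤ |α ^ 2 * (Real.exp (-|x|) * v x)| + |source α b a u v x| := abs_sub _ _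
    _ ≤ 1 / 100 * (Real.exp (-|x|) * m) + 3 * ε * Real.exp (-|x|) := by
      rw [abs_mul, abs_mul, Real.abs_exp, abs_of_nonneg (sq_nonneg α)]
      gcongr
      · exact hm x
      · refine (abs_source_le hb ha h x).trans ?_
        gcongr
        linarith [abs_nonneg x]
    _ = _ := by ring

theorem abs_sourceV_sub_le (ha : IsPotential ε a) (hb : IsPotential ε b) (h : IsProfile u v α)
    (h' : IsProfile u' v' α') (hu : ∀ y, |u y - u' y| ≤ Δ) (hv : ∀ y, |v y - v' y| ≤ Δ)
    (hα : |α - α'| ≤ Δ) (x : ℝ) :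
    |sourceV α a b u v x - sourceV α' a b u' v' x|
      ≤ (21 / 100 * Δ + 4 * ε * Δ) * Real.exp (-|x|) := by
  have hε := ha.nonneg
  have hΔ := (abs_nonneg _).trans hα
  have h₁ : |α ^ 2 * v x - α' ^ 2 * v' x| ≤ 21 / 100 * Δ := by
    have hα2 : α ^ 2 ≤ 1 / 100 := by
      rw [← sq_abs]
      nlinarith [abs_nonneg α, h.bounda]
    calc _ = |α ^ 2 * (v x - v' x) + (α - α') * (α + α') * v' x| := by ring_nf
      _ ≤ α ^ 2 * |v x - v' x| + |α - α'| * |α + α'| * |v' x| := by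
        refine (abs_add_le _ _).trans_eq ?_
        rw [abs_mul, abs_mul, abs_mul, abs_of_nonneg (sq_nonneg α)]
      _ ≤ 1 / 100 * Δ + Δ * (1 / 10 + 1 / 10) * 1 := by
        gcongr
        · exact hv x
        · exact (abs_add_le _ _).trans (add_le_add h.bounda h'.bounda)
        · exact h'.boundv x
      _ = _ := by ring
  calc _ = |Real.exp (-|x|) * (α ^ 2 * v x - α' ^ 2 * v' x)
        - (source α b a u v x - source α' b a u' v' x)| := by
        unfold sourceV
        ring_nf
    _ ≤ Real.exp (-|x|) * |α ^ 2 * v x - α' ^ 2 * v' x|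
        + |source α b a u v x - source α' b a u' v' x| := by
        refine (abs_sub _ _).trans_eq ?_
        rw [abs_mul, Real.abs_exp]
    _ ≤ Real.exp (-|x|) * (21 / 100 * Δ) + 4 * ε * Δ * Real.exp (-|x|) := by
      gcongr
      refine (abs_source_sub_le hb ha h h' hu hv hα x).trans ?_
      gcongr
      linarith [abs_nonneg x]
    _ = _ := by ring

theorem continuous_sourceV (ha : IsPotential ε a) (hb : IsPotential ε b) (h : IsProfile u v α) :
    Continuous (sourceV α a b u v) := by
  have h₁ := continuous_source hb ha h
  have h₂ := h.contv
  unfold sourceV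
  fun_prop

theorem abs_sourceV_le_const (ha : IsPotential ε a) (hb : IsPotential ε b) (h : IsProfile u v α)
    (x : ℝ) : |sourceV α a b u v x| ≤ 1 / 100 + 3 * ε := by
  have hε := ha.nonneg
  refine (abs_sourceV_le ha hb h h.boundv x).trans (mul_le_of_le_one_right (by positivity) ?_)
  simp

theorem continuous_nextV (ha : IsPotential ε a) (hb : IsPotential ε b) (h : IsProfile u v α) :
    Continuous (nextV α a b u v) := by
  obtain ⟨g, hg, -⟩ := exists_hasDerivAt_expConv (γ := √2) (by positivity)
    (continuous_sourceV ha hb h) (abs_sourceV_le_const ha hb h)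
  have hc : Continuous (expConv (√2) (sourceV α a b u v)) :=
    continuous_iff_continuousAt.2 fun y => (hg y).continuousAt
  unfold nextV
  fun_prop

theorem nextV_neg (ha : IsPotential ε a) (hb : IsPotential ε b) (h : IsProfile u v α) (y : ℝ) :
    nextV α a b u v (-y) = nextV α a b u v y := by
  rw [nextV, nextV, abs_neg, expConv_neg fun x => ?_]
  simp [sourceV, source_neg hb ha h, h.evenv]

theorem abs_nextV_le (ha : IsPotential ε a) (hb : IsPotential ε b) (h : IsProfile u v α)
    {m : ℝ} (hm : ∀ y, |v y| ≤ m) (y : ℝ) : |nextV α a b u v y| ≤ 2 * (m / 100 + 3 * ε) :=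
  abs_exp_mul_expConv_sqrt_two_le (abs_sourceV_le ha hb h hm) y

theorem integrable_exp_mul {f : ℝ → ℝ} {γ M : ℝ} (hγ : 0 < γ) (hf : Continuous f)
    (hM : ∀ x, |f x| ≤ M) (y : ℝ) : Integrable fun x => Real.exp (-(γ * |y - x|)) * f x := by
  have h := (integrable_exp_neg_mul_abs hγ).comp_sub_left y
  exact Integrable.mul_bdd (c := M) h hf.aestronglyMeasurable (Filter.Eventually.of_forall hM)

theorem expConv_sub {f g : ℝ → ℝ} {γ M : ℝ} (hγ : 0 < γ) (hf : Continuous f) (hg : Continuous g)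
    (hfM : ∀ x, |f x| ≤ M) (hgM : ∀ x, |g x| ≤ M) (y : ℝ) :
    expConv γ f y - expConv γ g y = expConv γ (fun x => f x - g x) y := by
  rw [expConv, expConv, expConv,
    ← integral_sub (integrable_exp_mul hγ hf hfM y) (integrable_exp_mul hγ hg hgM y)]
  simp only [mul_sub]

theorem abs_nextV_sub_le (ha : IsPotential ε a) (hb : IsPotential ε b) (h : IsProfile u v α)
    (h' : IsProfile u' v' α') (hu : ∀ y, |u y - u' y| ≤ Δ) (hv : ∀ y, |v y - v' y| ≤ Δ)
    (hα : |α - α'| ≤ Δ) (y : ℝ) :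
    |nextV α a b u v y - nextV α' a b u' v' y| ≤ 2 * (21 / 100 * Δ + 4 * ε * Δ) := by
  have := abs_exp_mul_expConv_sqrt_two_le (abs_sourceV_sub_le ha hb h h' hu hv hα) y
  rwa [← expConv_sub (by positivity) (continuous_sourceV ha hb h) (continuous_sourceV ha hb h')
    (abs_sourceV_le_const ha hb h) (abs_sourceV_le_const ha hb h'), mul_sub, mul_sub] at this

theorem IsProfile.next (hε : ε ≤ 1 / 1000) (ha : IsPotential ε a) (hb : IsPotential ε b)
    (h : IsProfile u v α) :
    IsProfile (nextU α a b u v) (nextV α a b u v) (nextRate α a b u v) where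
  contu := continuous_nextU ha hb h
  contv := continuous_nextV ha hb h
  evenu := nextU_neg ha hb h
  evenv := nextV_neg ha hb h
  boundu y := by
    have := abs_le.1 (abs_nextU_sub_one_le ha hb h y)
    rw [abs_le]
    constructor <;> linarith
  boundv y := (abs_nextV_le ha hb h h.boundv y).trans (by linarith)
  bounda := (abs_nextRate_le ha hb h).trans (by linarith)

end

open BoundedContinuousFunction in
/-- The fixed point: a self-consistent pair of profiles together with its decay rate. -/
theorem exists_profile {ε : ℝ} {a b : ℝ → ℝ} (hε : ε ≤ 1 / 1000) (ha : IsPotential ε a)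
    (hb : IsPotential ε b) :
    ∃ u v : ℝ → ℝ, ∃ α : ℝ, IsProfile u v α ∧ u = nextU α a b u v ∧ v = nextV α a b u v ∧
      α = nextRate α a b u v ∧ ∀ y, |v y| ≤ 7 * ε := by
  have hε0 := ha.nonneg
  let S : Set ((ℝ →ᵇ ℝ) × (ℝ →ᵇ ℝ) × ℝ) := {p | IsProfile p.1 p.2.1 p.2.2}
  have hS : IsClosed S := by
    have e : S = (⋂ y, {p | p.1 (-y) = p.1 y}) ∩ (⋂ y, {p | p.2.1 (-y) = p.2.1 y}) ∩
        (⋂ y, {p | |p.1 y| ≤ 2}) ∩ (⋂ y, {p | |p.2.1 y| ≤ 1}) ∩ {p | |p.2.2| ≤ 1 / 10} := by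
      ext p
      simp only [S, Set.mem_inter_iff, Set.mem_iInter, Set.mem_ofPred_eq]
      exact ⟨fun h => ⟨⟨⟨⟨h.evenu, h.evenv⟩, h.boundu⟩, h.boundv⟩, h.bounda⟩,
        fun ⟨⟨⟨⟨h₁, h₂⟩, h₃⟩, h₄⟩, h₅⟩ => ⟨p.1.continuous, p.2.1.continuous, h₁, h₂, h₃, h₄, h₅⟩⟩
    have c₁ (y : ℝ) : Continuous fun p : (ℝ →ᵇ ℝ) × (ℝ →ᵇ ℝ) × ℝ => p.1 y :=
      (continuous_eval_const y).comp continuous_fst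
    have c₂ (y : ℝ) : Continuous fun p : (ℝ →ᵇ ℝ) × (ℝ →ᵇ ℝ) × ℝ => p.2.1 y :=
      (continuous_eval_const y).comp (continuous_fst.comp continuous_snd)
    have c₃ : Continuous fun p : (ℝ →ᵇ ℝ) × (ℝ →ᵇ ℝ) × ℝ => p.2.2 := by fun_prop
    rw [e]
    refine (((IsClosed.inter ?_ ?_).inter ?_).inter ?_).inter ?_
    · exact isClosed_iInter fun y => isClosed_eq (c₁ _) (c₁ _)
    · exact isClosed_iInter fun y => isClosed_eq (c₂ _) (c₂ _)
    · exact isClosed_iInter fun y => isClosed_le (c₁ _).abs continuous_const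
    · exact isClosed_iInter fun y => isClosed_le (c₂ _).abs continuous_const
    · exact isClosed_le c₃.abs continuous_const
  have : CompleteSpace S := hS.completeSpace_coe
  have : Nonempty S := ⟨⟨(0, 0, 0), by constructor <;> simp [continuous_zero]⟩⟩
  let F : S → S := fun p =>
    have h := IsProfile.next hε ha hb p.2
    ⟨(ofNormedAddCommGroup _ h.contu 2 h.boundu, ofNormedAddCommGroup _ h.contv 1 h.boundv,
      nextRate p.1.2.2 a b p.1.1 p.1.2.1), h⟩
  have hF : ContractingWith (1 / 2) F := by
    refine ⟨by norm_num, LipschitzWith.of_dist_le_mul fun p q => ?_⟩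
    obtain ⟨hu, hvα⟩ := max_le_iff.1 (Prod.dist_eq (x := p.1) (y := q.1)).ge
    obtain ⟨hv, hα⟩ := max_le_iff.1 ((Prod.dist_eq (x := p.1.2) (y := q.1.2)).ge.trans hvα)
    have hu' (y : ℝ) := (dist_coe_le_dist y).trans hu
    have hv' (y : ℝ) := (dist_coe_le_dist y).trans hv
    rw [Subtype.dist_eq, Subtype.dist_eq]
    set Δ := dist p.1 q.1
    have hΔ : 0 ≤ Δ := dist_nonneg
    have hεΔ : ε * Δ ≤ 1 / 1000 * Δ := by gcongr
    have hK : ((1 / 2 : NNReal) : ℝ) * Δ = Δ / 2 := by push_cast; ring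
    rw [hK, Prod.dist_eq, Prod.dist_eq]
    refine max_le ?_ (max_le ?_ ?_)
    · exact (dist_le (by positivity)).2 fun y =>
        (abs_nextU_sub_le ha hb p.2 q.2 hu' hv' hα y).trans (by linarith)
    · exact (dist_le (by positivity)).2 fun y =>
        (abs_nextV_sub_le ha hb p.2 q.2 hu' hv' hα y).trans (by linarith)
    · exact (abs_nextRate_sub_le ha hb p.2 q.2 hu' hv' hα).trans (by linarith)
  set p := ContractingWith.fixedPoint F hF
  have hp : F p = p := hF.fixedPoint_isFixedPt
  have hp₁ : nextU p.1.2.2 a b p.1.1 p.1.2.1 = p.1.1 := congrArg (fun q : S => ⇑q.1.1) hp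
  have hp₂ : nextV p.1.2.2 a b p.1.1 p.1.2.1 = p.1.2.1 := congrArg (fun q : S => ⇑q.1.2.1) hp
  have hp₃ : nextRate p.1.2.2 a b p.1.1 p.1.2.1 = p.1.2.2 := congrArg (fun q : S => q.1.2.2) hp
  refine ⟨p.1.1, p.1.2.1, p.1.2.2, p.2, hp₁.symm, hp₂.symm, hp₃.symm, fun y => ?_⟩
  have hn : ‖p.1.2.1‖ ≤ 2 * (‖p.1.2.1‖ / 100 + 3 * ε) :=
    (norm_le (by positivity)).2 fun y => by
      have := abs_nextV_le ha hb p.2 p.1.2.1.norm_coe_le_norm y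
      rwa [hp₂] at this
  have := p.1.2.1.norm_coe_le_norm y
  rw [Real.norm_eq_abs] at this
  linarith

theorem exp_mul_profile_eq {ε α : ℝ} {a b u v : ℝ → ℝ} (ha : IsPotential ε a)
    (hb : IsPotential ε b) (h : IsProfile u v α) (hα0 : 0 < α) (hu : u = nextU α a b u v)
    (hα : α = nextRate α a b u v) (y : ℝ) :
    Real.exp (-(α * |y|)) * u y = -(1 / (2 * α)) * expConv α (source α a b u v) y := by
  have hε := ha.nonneg
  have h₁ := source_integrable ha hb h
  have h₂ := integrable_exp_mul hα0 (continuous_source ha hb h) (M := 3 * ε)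
    (fun x => (abs_source_le ha hb h x).trans
      (mul_le_of_le_one_right (by positivity) (by simp))) y
  have h₃ : α * ∫ x, expQuot α (|y| - |y - x|) * source α a b u v x
      = Real.exp (α * |y|) * expConv α (source α a b u v) y - ∫ x, source α a b u v x := by
    rw [expConv, ← integral_const_mul, ← integral_const_mul,
      ← integral_sub (h₂.const_mul _) h₁]
    congr 1 with x
    rw [← mul_assoc, mul_expQuot, ← mul_assoc, ← Real.exp_add]
    ring_nf
  have h₄ : Real.exp (-(α * |y|)) * Real.exp (α * |y|) = 1 := by rw [← Real.exp_add]; simp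
  have h₅ : α * u y = -(1 / 2) * (Real.exp (α * |y|) * expConv α (source α a b u v) y) := by
    rw [congrFun hu y, nextU]
    rw [nextRate] at hα
    linear_combination hα - 1 / 2 * h₃
  have h₆ : u y = -(1 / (2 * α)) * (Real.exp (α * |y|) * expConv α (source α a b u v) y) := by
    field_simp
    linear_combination 2 * h₅
  rw [h₆]
  linear_combination -(1 / (2 * α)) * expConv α (source α a b u v) y * h₄

theorem contDiff_two_of_hasDerivAt {f g k : ℝ → ℝ} (hf : ∀ y, HasDerivAt f (g y) y)
    (hg : ∀ y, HasDerivAt g (k y) y) (hk : Continuous k) : ContDiff ℝ 2 f := by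
  have e₁ : deriv f = g := funext fun y => (hf y).deriv
  have e₂ : deriv g = k := funext fun y => (hg y).deriv
  rw [show (2 : WithTop ℕ∞) = 1 + 1 from by norm_num, contDiff_succ_iff_deriv]
  refine ⟨fun y => (hf y).differentiableAt, by simp, ?_⟩
  rw [e₁, contDiff_one_iff_deriv, e₂]
  exact ⟨fun y => (hg y).differentiableAt, hk⟩

/-- The components `Z₁ = exp (-α|·|) u` and `Z₂ = exp (-|·|) v` of a fixed point solve the
diagonalised system. -/
theorem exists_hasDerivAt_components {ε α : ℝ} {a b u v : ℝ → ℝ} (ha : IsPotential ε a)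
    (hb : IsPotential ε b) (h : IsProfile u v α) (hα0 : 0 < α) (hu : u = nextU α a b u v)
    (hv : v = nextV α a b u v) (hα : α = nextRate α a b u v) :
    ∃ Z₁ Z₂ D₁ D₂ : ℝ → ℝ, (∀ y, Z₁ y = Real.exp (-(α * |y|)) * u y) ∧
      (∀ y, Z₂ y = Real.exp (-|y|) * v y) ∧
      (∀ y, HasDerivAt Z₁ (D₁ y) y) ∧ (∀ y, HasDerivAt Z₂ (D₂ y) y) ∧
      (∀ y, HasDerivAt D₁ (α ^ 2 * Z₁ y + (a y * Z₁ y + b y * Z₂ y)) y) ∧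
      (∀ y, HasDerivAt D₂ ((2 - α ^ 2) * Z₂ y + (b y * Z₁ y + a y * Z₂ y)) y) := by
  have hε := ha.nonneg
  obtain ⟨P, hP, hP'⟩ := exists_hasDerivAt_expConv hα0 (continuous_source ha hb h) (M := 3 * ε)
    (fun x => (abs_source_le ha hb h x).trans
      (mul_le_of_le_one_right (by positivity) (by simp)))
  obtain ⟨Q, hQ, hQ'⟩ := exists_hasDerivAt_expConv (γ := √2) (by positivity)
    (continuous_sourceV ha hb h) (abs_sourceV_le_const ha hb h)
  have e₂ (y : ℝ) : 1 / (2 * √2) * expConv (√2) (sourceV α a b u v) y = Real.exp (-|y|) * v y := by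
    rw [congrFun hv y, nextV, ← mul_assoc (Real.exp _), ← Real.exp_add]
    simp
  have e₁ := exp_mul_profile_eq ha hb h hα0 hu hα
  refine ⟨fun y => -(1 / (2 * α)) * expConv α (source α a b u v) y,
    fun y => 1 / (2 * √2) * expConv (√2) (sourceV α a b u v) y,
    fun y => -(1 / (2 * α)) * P y, fun y => 1 / (2 * √2) * Q y, fun y => (e₁ y).symm, e₂,
    fun y => (hP y).const_mul _, fun y => (hQ y).const_mul _,
    fun y => ((hP' y).const_mul _).congr_deriv ?_, fun y => ((hQ' y).const_mul _).congr_deriv ?_⟩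
  · beta_reduce
    rw [e₂, ← e₁]
    have : expConv α (source α a b u v) y = -(2 * α) * (Real.exp (-(α * |y|)) * u y) := by
      rw [e₁]
      field_simp
    rw [this, source]
    field_simp
    ring
  · beta_reduce
    rw [e₂, ← e₁, Real.sq_sqrt zero_le_two]
    have h₀ : 1 / (2 * √2) * (2 * √2) = 1 := by field_simp
    have h₁ : sourceV α a b u v y = α ^ 2 * (Real.exp (-|y|) * v y)
      - (b y * (Real.exp (-(α * |y|)) * u y) + a y * (Real.exp (-|y|) * v y)) := rfl
    linear_combination 2 * e₂ y - sourceV α a b u v y * h₀ - h₁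

theorem stmt1 :
    ∃ ε₀ ∈ Set.Ioo (0:ℝ) 1, ∃ C : ℝ, 0 < C ∧
      ∀ (ap am : ℝ → ℝ) (ε I : ℝ),
        Continuous ap → Continuous am →
        (∀ y, ap (-y) = ap y) → (∀ y, am (-y) = am y) →
        (∀ y, |ap y| ≤ ε * Real.exp (-2 * |y|)) →
        (∀ y, |am y| ≤ ε * Real.exp (-2 * |y|)) →
        I = -∫ y : ℝ, (ap y + am y) →
        0 < ε → ε ≤ ε₀ → 0 < I → ε ^ 2 ≤ ε₀ * I →
        ∃ α : ℝ, 0 < α ∧ |α - I / 4| ≤ C * ε ^ 2 ∧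
          ∃ W₁ W₂ : ℝ → ℝ,
            (∃ M, ∀ y, |W₁ y| ≤ M) ∧ (∃ M, ∀ y, |W₂ y| ≤ M) ∧
            (∀ y, W₁ (-y) = W₁ y) ∧ (∀ y, W₂ (-y) = W₂ y) ∧
            ContDiff ℝ 2 W₁ ∧ ContDiff ℝ 2 W₂ ∧
            (∀ y, -(deriv (deriv W₁) y) + W₁ y + ap y * W₁ y = (1 - α ^ 2) * W₂ y) ∧
            (∀ y, -(deriv (deriv W₂) y) + W₂ y + am y * W₂ y = (1 - α ^ 2) * W₁ y) ∧
            (∀ y, |W₁ y - Real.exp (-α * |y|)| ≤ C * (ε ^ 2 / I) * Real.exp (-α * |y|)) ∧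
            (∀ y, |W₂ y - Real.exp (-α * |y|)| ≤ C * (ε ^ 2 / I) * Real.exp (-α * |y|)) ∧
            (∀ y, |W₁ y - W₂ y| ≤ C * ε * Real.exp (-|y|)) := by
  refine ⟨1 / 1000, by norm_num, 1000, by norm_num, ?_⟩
  intro ap am ε I hap ham hap_even ham_even hap_le ham_le hI hε hε₀ hI0 hεI
  set a : ℝ → ℝ := fun y => (ap y + am y) / 2
  set b : ℝ → ℝ := fun y => (ap y - am y) / 2
  have ha : IsPotential ε a := by
    refine ⟨by fun_prop, fun y => by simp [a, hap_even, ham_even], fun y => ?_⟩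
    have h₁ := abs_le.1 (hap_le y)
    have h₂ := abs_le.1 (ham_le y)
    rw [abs_le]
    constructor <;> simp only [a] <;> linarith
  have hb : IsPotential ε b := by
    refine ⟨by fun_prop, fun y => by simp [b, hap_even, ham_even], fun y => ?_⟩
    have h₁ := abs_le.1 (hap_le y)
    have h₂ := abs_le.1 (ham_le y)
    rw [abs_le]
    constructor <;> simp only [b] <;> linarith
  have hunit : IsProfile (fun _ => 1) (fun _ => 0) 0 := by
    constructor <;> simp [continuous_const]
  have hrate : nextRate 0 a b (fun _ => 1) (fun _ => 0) = I / 4 := by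
    have e : source 0 a b (fun _ => 1) (fun _ => 0) = fun y => 1 / 2 * (ap y + am y) := by
      ext y
      simp only [source, a]
      simp
      ring
    rw [nextRate, e, integral_const_mul, hI]
    ring
  obtain ⟨u, v, α, h, hu, hv, hα, hv7⟩ := exists_profile hε₀ ha hb
  have hu15 (y : ℝ) : |u y - 1| ≤ 15 * ε := by
    have := abs_nextU_sub_one_le ha hb h y
    rwa [← hu] at this
  have hα8 : |α| ≤ 15 / 2 * ε := by
    have := abs_nextRate_le ha hb h
    rwa [← hα] at this
  have hαI : |α - I / 4| ≤ 150 * ε ^ 2 := by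
    have := abs_nextRate_sub_le (Δ := 15 * ε) ha hb h hunit hu15
      (fun y => by simpa using (hv7 y).trans (by linarith)) (by simpa using hα8.trans (by linarith))
    rw [← hα, hrate] at this
    linarith
  have hα0 : 0 < α := by
    have := (abs_le.1 hαI).1
    linarith
  have hα1 : α ≤ 1 := by linarith [le_abs_self α, h.bounda]
  have hεI' : ε ≤ 30 * (ε ^ 2 / I) := by
    have hI30 : I ≤ 30 * ε := by
      have := abs_nextRate_le ha hb hunit
      rw [hrate] at this
      linarith [le_abs_self (I / 4)]
    rw [← mul_div_assoc, le_div_iff₀ hI0]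
    nlinarith
  obtain ⟨Z₁, Z₂, D₁, D₂, hZ₁, hZ₂, hD₁, hD₂, hE₁, hE₂⟩ :=
    exists_hasDerivAt_components ha hb h hα0 hu hv hα
  have hZ₁c : Continuous Z₁ := continuous_iff_continuousAt.2 fun y => (hD₁ y).continuousAt
  have hZ₂c : Continuous Z₂ := continuous_iff_continuousAt.2 fun y => (hD₂ y).continuousAt
  have hac := ha.cont
  have hbc := hb.cont
  have hap' (y : ℝ) : ap y = a y + b y := by simp only [a, b]; ring
  have ham' (y : ℝ) : am y = a y - b y := by simp only [a, b]; ring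
  have hdecay (y : ℝ) : Real.exp (-|y|) ≤ Real.exp (-(α * |y|)) := by
    gcongr
    exact mul_le_of_le_one_left (abs_nonneg y) hα1
  have hZ₁e (y : ℝ) : Z₁ (-y) = Z₁ y := by rw [hZ₁, hZ₁, h.evenu, abs_neg]
  have hZ₂e (y : ℝ) : Z₂ (-y) = Z₂ y := by rw [hZ₂, hZ₂, h.evenv, abs_neg]
  have hZ₁b (y : ℝ) : |Z₁ y| ≤ 2 := by
    rw [hZ₁, abs_mul, Real.abs_exp]
    exact (mul_le_of_le_one_left (abs_nonneg _)
      (Real.exp_le_one_iff.2 (neg_nonpos.2 (by positivity)))).trans (h.boundu y)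
  have hZ₂7 (y : ℝ) : |Z₂ y| ≤ 7 * ε * Real.exp (-|y|) := by
    rw [hZ₂, abs_mul, Real.abs_exp, mul_comm]
    gcongr
    exact hv7 y
  have hZ₂b (y : ℝ) : |Z₂ y| ≤ 7 * ε :=
    (hZ₂7 y).trans (mul_le_of_le_one_right (by positivity) (by simp))
  have hclose (y : ℝ) : |Z₁ y - Real.exp (-α * |y|)| + |Z₂ y|
      ≤ 1000 * (ε ^ 2 / I) * Real.exp (-α * |y|) := by
    rw [neg_mul]
    have h₁ : |Z₁ y - Real.exp (-(α * |y|))| ≤ 15 * ε * Real.exp (-(α * |y|)) := by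
      rw [hZ₁, show Real.exp (-(α * |y|)) * u y - Real.exp (-(α * |y|))
        = (u y - 1) * Real.exp (-(α * |y|)) by ring, abs_mul, Real.abs_exp]
      gcongr
      exact hu15 y
    have h₂ : |Z₂ y| ≤ 7 * ε * Real.exp (-(α * |y|)) :=
      (hZ₂7 y).trans (mul_le_mul_of_nonneg_left (hdecay y) (by positivity))
    calc _ ≤ 22 * ε * Real.exp (-(α * |y|)) := by linarith
      _ ≤ _ := by
        refine mul_le_mul_of_nonneg_right ?_ (Real.exp_pos _).le
        linarith [show 0 ≤ ε ^ 2 / I by positivity]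
  have d₁ (y : ℝ) : HasDerivAt (fun y => Z₁ y + Z₂ y) (D₁ y + D₂ y) y := (hD₁ y).add (hD₂ y)
  have d₂ (y : ℝ) : HasDerivAt (fun y => Z₁ y - Z₂ y) (D₁ y - D₂ y) y := (hD₁ y).sub (hD₂ y)
  have dd₁ (y : ℝ) : HasDerivAt (fun y => D₁ y + D₂ y) _ y := (hE₁ y).add (hE₂ y)
  have dd₂ (y : ℝ) : HasDerivAt (fun y => D₁ y - D₂ y) _ y := (hE₁ y).sub (hE₂ y)
  refine ⟨α, hα0, hαI.trans (by gcongr; norm_num), fun y => Z₁ y + Z₂ y, fun y => Z₁ y - Z₂ y,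
    ⟨2 + 7 * ε, fun y => (abs_add_le _ _).trans (add_le_add (hZ₁b y) (hZ₂b y))⟩,
    ⟨2 + 7 * ε, fun y => (abs_sub _ _).trans (add_le_add (hZ₁b y) (hZ₂b y))⟩,
    fun y => by simp only [hZ₁e, hZ₂e], fun y => by simp only [hZ₁e, hZ₂e],
    contDiff_two_of_hasDerivAt d₁ dd₁ (by fun_prop),
    contDiff_two_of_hasDerivAt d₂ dd₂ (by fun_prop), fun y => ?_, fun y => ?_, fun y => ?_,
    fun y => ?_, fun y => ?_⟩
  · rw [funext fun y => (d₁ y).deriv, (dd₁ y).deriv, hap']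
    ring
  · rw [funext fun y => (d₂ y).deriv, (dd₂ y).deriv, ham']
    ring
  · rw [add_sub_right_comm]
    exact (abs_add_le _ _).trans (hclose y)
  · rw [sub_right_comm]
    exact (abs_sub _ _).trans (hclose y)
  · rw [show Z₁ y + Z₂ y - (Z₁ y - Z₂ y) = 2 * Z₂ y by ring, abs_mul, abs_two]
    have : 0 ≤ ε * Real.exp (-|y|) := by positivity
    linarith [hZ₂7 y]
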